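/- The center of the braid group B₄ is generated by (σ₁σ₂σ₃)⁴. -/

import Mathlib

/-- The Artin relations for the braid group `B₄` on generators `σ₁ σ₂ σ₃`
(indexed by `0 1 2`). -/
def braidRels4 : Set (FreeGroup (Fin 3)) :=
  { FreeGroup.of 0 * FreeGroup.of 1 * FreeGroup.of 0 *
      (FreeGroup.of 1 * FreeGroup.of 0 * FreeGroup.of 1)⁻¹,
    FreeGroup.of 1 * FreeGroup.of 2 * FreeGroup.of 1 *
      (FreeGroup.of 2 * FreeGroup.of 1 * FreeGroup.of 2)⁻¹,
    FreeGroup.of 0 * FreeGroup.of 2 * (FreeGroup.of 2 * FreeGroup.of 0)⁻¹ }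

/-- The braid group on four strands. -/
abbrev BraidGroup4 : Type := PresentedGroup braidRels4

/-- The Artin generators of `B₄`. -/
def σB (i : Fin 3) : BraidGroup4 := PresentedGroup.of i

open Matrix

section BraidRelations

variable {G : Type*} [Group G] {s t u : G}

theorem braid_conj (h : s * t * s = t * s * t) : s * t * s⁻¹ = t⁻¹ * s * t := by
  calc s * t * s⁻¹ = t⁻¹ * (t * s * t) * s⁻¹ := by group
    _ = t⁻¹ * (s * t * s) * s⁻¹ := by rw [h]
    _ = t⁻¹ * s * t := by group

theorem braid_conj_inv (h : s * t * s = t * s * t) : s * t⁻¹ * s⁻¹ = t⁻¹ * s⁻¹ * t := by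
  simpa [mul_assoc] using congrArg (·⁻¹) (braid_conj h)

theorem conj_fst (hst : s * t * s = t * s * t) (htu : t * u * t = u * t * u) :
    s * (t * (s * u⁻¹) * t⁻¹) * s⁻¹ = t * (s * u⁻¹) * t⁻¹ * (s * u⁻¹)⁻¹ := by
  calc s * (t * (s * u⁻¹) * t⁻¹) * s⁻¹ = (s * t * s) * u⁻¹ * t⁻¹ * s⁻¹ := by group
    _ = t * s * (t * u⁻¹ * t⁻¹) * s⁻¹ := by rw [hst]; group
    _ = t * (s * u⁻¹) * t⁻¹ * (s * u⁻¹)⁻¹ := by rw [braid_conj_inv htu]; group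

theorem conj_snd (hst : s * t * s = t * s * t) (htu : t * u * t = u * t * u)
    (hsu : s * u = u * s) :
    t * (t * (s * u⁻¹) * t⁻¹) * t⁻¹ =
      t * (s * u⁻¹) * t⁻¹ * (s * u⁻¹)⁻¹ * (t * (s * u⁻¹) * t⁻¹) := by
  have hus : u * s⁻¹ = s⁻¹ * u := (Commute.inv_left (show Commute s u from hsu)).eq.symm
  have key : s * u⁻¹ * (t * (s * u⁻¹) * t⁻¹)⁻¹ * (s * u⁻¹) = t⁻¹ * (s * u⁻¹) * t := by
    calc s * u⁻¹ * (t * (s * u⁻¹) * t⁻¹)⁻¹ * (s * u⁻¹)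
        = s * (u⁻¹ * t * u) * (s⁻¹ * t⁻¹ * s) * u⁻¹ := by group
      _ = s * t * (u * s⁻¹) * t⁻¹ * u⁻¹ := by
        rw [← braid_conj htu, ← braid_conj_inv hst.symm]; group
      _ = (s * t * s⁻¹) * (u * t⁻¹ * u⁻¹) := by rw [hus]; group
      _ = t⁻¹ * (s * u⁻¹) * t := by rw [braid_conj hst, braid_conj_inv htu.symm]; group
  calc t * (t * (s * u⁻¹) * t⁻¹) * t⁻¹
      = t * (s * u⁻¹) * t⁻¹ *
          (t * (s * u⁻¹ * (t * (s * u⁻¹) * t⁻¹)⁻¹ * (s * u⁻¹)) * t⁻¹)⁻¹ *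
          (t * (s * u⁻¹) * t⁻¹) := by group
    _ = _ := by rw [key]; group

theorem conj_trd (hst : s * t * s = t * s * t) (htu : t * u * t = u * t * u) :
    u * (t * (s * u⁻¹) * t⁻¹) * u⁻¹ = (s * u⁻¹)⁻¹ * (t * (s * u⁻¹) * t⁻¹) := by
  calc u * (t * (s * u⁻¹) * t⁻¹) * u⁻¹ = u * t * s * (u * t * u)⁻¹ := by group
    _ = u * (t * s * t⁻¹) * u⁻¹ * t⁻¹ := by rw [← htu]; group
    _ = (s * u⁻¹)⁻¹ * (t * (s * u⁻¹) * t⁻¹) := by rw [braid_conj hst.symm]; group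

theorem commute_full_twist (hst : s * t * s = t * s * t) (htu : t * u * t = u * t * u)
    (hsu : s * u = u * s) :
    Commute s ((s * t * u) ^ 4) ∧ Commute t ((s * t * u) ^ 4) ∧ Commute u ((s * t * u) ^ 4) := by
  have h1 : SemiconjBy (s * t * u) s t := by
    show s * t * u * s = t * (s * t * u)
    calc s * t * u * s = s * t * (u * s) := by group
      _ = (s * t * s) * u := by rw [← hsu]; group
      _ = t * (s * t * u) := by rw [hst]; group
  have h2 : SemiconjBy (s * t * u) t u := by
    show s * t * u * t = u * (s * t * u)
    calc s * t * u * t = s * (t * u * t) := by group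
      _ = (s * u) * t * u := by rw [htu]; group
      _ = u * (s * t * u) := by rw [hsu]; group
  have h3 : SemiconjBy (s * t * u * (s * t * u)) u s := by
    show s * t * u * (s * t * u) * u = s * (s * t * u * (s * t * u))
    calc s * t * u * (s * t * u) * u = s * t * (u * s) * t * u * u := by group
      _ = s * t * s * (u * t * u) * u := by rw [← hsu]; group
      _ = s * (t * s * t) * u * t * u := by rw [← htu]; group
      _ = s * (s * t * (s * u) * t * u) := by rw [← hst]; group
      _ = s * (s * t * u * (s * t * u)) := by rw [hsu]; group
  generalize s * t * u = d at h1 h2 h3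
  have hd : d ^ 4 = d * d * (d * d) := by simp [pow_succ, mul_assoc]
  have hd' : d ^ 4 = d * (d * d * d) := by simp [pow_succ, mul_assoc]
  refine ⟨?_, ?_, ?_⟩
  · rw [hd]; exact (h3.mul_left (h2.mul_left h1) : Commute _ s).symm
  · rw [hd']; exact (h1.mul_left (h3.mul_left h2) : Commute _ t).symm
  · rw [hd]; exact ((h2.mul_left h1).mul_left h3 : Commute _ u).symm

/-- If the fourth power of the Garside element `s * t * s` is trivial, every element of the group
generated by `s` and `t` is `(sts)ⁱ m (st)ʲ` with `m` a positive word in `s` and `t⁻¹`. -/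
theorem exists_normal_form (hst : s * t * s = t * s * t) (hx : (s * t * s) ^ 4 = 1) {p : G}
    (hp : p ∈ Subgroup.closure {s, t}) :
    ∃ i : ℕ, ∃ j < 3, ∃ m ∈ Submonoid.closure {s, t⁻¹},
      p = (s * t * s) ^ i * m * (s * t) ^ j := by
  obtain ⟨x, hxd⟩ : ∃ x, x = s * t * s := ⟨_, rfl⟩
  obtain ⟨y, hyd⟩ : ∃ y, y = s * t := ⟨_, rfl⟩
  rw [← hxd] at hx ⊢
  rw [← hyd]
  have hxs : x * s = t * x := by subst hxd; rw [hst, mul_assoc, mul_assoc, ← mul_assoc s, hst]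
  have hxt : x * t = s * x := by subst hxd; rw [mul_assoc s t s, mul_assoc s, ← hst, mul_assoc]
  have hy2 : y ^ 2 = s * x := by subst hxd hyd; rw [hst, pow_two]; group
  have hy : y = t⁻¹ * x := by subst hxd hyd; rw [hst]; group
  have hys : y * s = x := by subst hxd hyd; rfl
  have hyx : y * x = t⁻¹ * x ^ 2 := by rw [hy, pow_two, mul_assoc]
  have hy2x : y ^ 2 * x = s * x ^ 2 := by rw [hy2, pow_two, mul_assoc]
  have hy3 : y ^ 3 = x ^ 2 := by
    calc y ^ 3 = y * y ^ 2 := by group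
      _ = (y * s) * x := by rw [hy2]; group
      _ = x ^ 2 := by rw [hys, pow_two]
  have cs : Commute (x ^ 2) s := by
    show x ^ 2 * s = s * x ^ 2
    rw [pow_two, mul_assoc, hxs, ← mul_assoc, hxt, mul_assoc]
  have ct : Commute (x ^ 2) t := by
    show x ^ 2 * t = t * x ^ 2
    rw [pow_two, mul_assoc, hxt, ← mul_assoc, hxs, mul_assoc]
  have cm : ∀ m ∈ Submonoid.closure {s, t⁻¹}, Commute (x ^ 2) m := by
    intro m hm
    induction hm using Submonoid.closure_induction with
    | mem a ha =>
      rcases ha with rfl | rfl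
      exacts [cs, ct.inv_right]
    | one => exact Commute.one_right _
    | mul a b _ _ ha hb => exact ha.mul_right hb
  have hs : s ∈ Submonoid.closure {s, t⁻¹} := Submonoid.subset_closure (by simp)
  have ht : t⁻¹ ∈ Submonoid.closure {s, t⁻¹} := Submonoid.subset_closure (by simp)
  set N : G → Prop := fun p =>
    ∃ i : ℕ, ∃ j < 3, ∃ m ∈ Submonoid.closure {s, t⁻¹}, p = x ^ i * m * y ^ j
  have Nx : ∀ p, N p → N (p * x) := by
    rintro _ ⟨i, j, hj, m, hm, rfl⟩
    interval_cases j
    · induction hm using Submonoid.closure_induction_right with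
      | one => exact ⟨i + 1, 0, by simp, 1, one_mem _, by group⟩
      | mul_right m hm a ha =>
        rcases ha with rfl | rfl
        · exact ⟨i, 2, by simp, m, hm, by rw [hy2]; group⟩
        · exact ⟨i, 1, by simp, m, hm, by rw [pow_one, hy]; group⟩
    · refine ⟨i + 2, 0, by simp, m * t⁻¹, mul_mem hm ht, ?_⟩
      rw [pow_one, mul_assoc, hyx, pow_add, mul_assoc (x ^ i) (x ^ 2),
        (cm _ (mul_mem hm ht)).eq]
      group
    · refine ⟨i + 2, 0, by simp, m * s, mul_mem hm hs, ?_⟩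
      rw [mul_assoc, hy2x, pow_add, mul_assoc (x ^ i) (x ^ 2), (cm _ (mul_mem hm hs)).eq]
      group
  have Ny : ∀ p, N p → N (p * y) := by
    rintro _ ⟨i, j, hj, m, hm, rfl⟩
    interval_cases j
    · exact ⟨i, 1, by simp, m, hm, by group⟩
    · exact ⟨i, 2, by simp, m, hm, by group⟩
    · refine ⟨i + 2, 0, by simp, m, hm, ?_⟩
      rw [mul_assoc, ← pow_succ, hy3, pow_add, mul_assoc (x ^ i) (x ^ 2), (cm _ hm).eq]
      group
  have Nxn : ∀ (n : ℕ) p, N p → N (p * x ^ n) := by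
    intro n p hp
    induction n with
    | zero => simpa using hp
    | succ n ih => rw [pow_succ, ← mul_assoc]; exact Nx _ ih
  have hx3 : x ^ 3 = x⁻¹ := eq_inv_of_mul_eq_one_left (by rw [← pow_succ, hx])
  have Nxi : ∀ p, N p → N (p * x⁻¹) := fun p hp => hx3 ▸ Nxn 3 p hp
  have Ns : ∀ p, N p → N (p * s) := by
    intro p hp
    have : p * s = p * y * y * x⁻¹ := by rw [mul_assoc p, ← pow_two, hy2]; group
    rw [this]
    exact Nxi _ (Ny _ (Ny _ hp))
  induction hp using Subgroup.closure_induction_right with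
  | one => exact ⟨0, 0, by simp, 1, one_mem _, by simp⟩
  | mul_right p _ a ha ih =>
    rcases ha with rfl | rfl
    · exact Ns _ ih
    · have : p * a = p * x * s * x⁻¹ := by rw [mul_assoc p, hxs]; group
      rw [this]
      exact Nxi _ (Ns _ (Nx _ ih))
  | mul_inv_cancel p _ a ha ih =>
    rcases ha with rfl | rfl
    · have : p * a⁻¹ = p * x⁻¹ * y := by rw [← hys]; group
      rw [this]
      exact Ny _ (Nxi _ ih)
    · have : p * a⁻¹ = p * y * x⁻¹ := by rw [hy]; group
      rw [this]
      exact Nxi _ (Ny _ ih)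

end BraidRelations

section Matrices

/-- The image of `σ₁` and `σ₃` in `SL(2, ℤ)`. -/
def upperSL : Matrix.SpecialLinearGroup (Fin 2) ℤ := ⟨!![1, 1; 0, 1], by decide⟩

/-- The image of `σ₂` in `SL(2, ℤ)`. -/
def lowerSL : Matrix.SpecialLinearGroup (Fin 2) ℤ := ⟨!![1, 0; -1, 1], by decide⟩

theorem upperSL_braid_lowerSL : upperSL * lowerSL * upperSL = lowerSL * upperSL * lowerSL := by
  decide

theorem garsideSL_pow_four : (upperSL * lowerSL * upperSL) ^ 4 = 1 := by
  decide

theorem coe_upperSL : (↑upperSL : Matrix (Fin 2) (Fin 2) ℤ) = !![1, 1; 0, 1] := rfl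

theorem coe_lowerSL : (↑lowerSL : Matrix (Fin 2) (Fin 2) ℤ) = !![1, 0; -1, 1] := rfl

theorem coe_inv_lowerSL : (↑lowerSL⁻¹ : Matrix (Fin 2) (Fin 2) ℤ) = !![1, 0; 1, 1] := by
  rw [Matrix.SpecialLinearGroup.coe_inv, coe_lowerSL, adjugate_fin_two_of]
  simp

variable {Q : Type*} [Group Q] {s t : Q}

theorem entries_of_mem_closure {m : Q × Matrix.SpecialLinearGroup (Fin 2) ℤ}
    (hm : m ∈ Submonoid.closure {(s, upperSL), (t, lowerSL)⁻¹}) :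
    1 ≤ m.2 0 0 ∧ 0 ≤ m.2 0 1 ∧ 0 ≤ m.2 1 0 ∧ 1 ≤ m.2 1 1 ∧
      (m.2 0 1 = 0 → m.2 1 0 = 0 → m = 1) := by
  induction hm using Submonoid.closure_induction_right with
  | one => simp
  | mul_right m _ a ha ih =>
    obtain ⟨h00, h01, h10, h11, -⟩ := ih
    rcases ha with rfl | rfl
    · simp only [Prod.snd_mul, Matrix.SpecialLinearGroup.coe_mul, Matrix.mul_apply,
        Fin.sum_univ_two, coe_upperSL]
      simp
      refine ⟨by omega, by omega, by omega, by omega, fun _ _ => by omega⟩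
    · simp only [Prod.snd_mul, Prod.snd_inv, Matrix.SpecialLinearGroup.coe_mul, Matrix.mul_apply,
        Fin.sum_univ_two, coe_inv_lowerSL]
      simp
      refine ⟨by omega, by omega, by omega, by omega, fun _ _ => by omega⟩

theorem eq_zero_of_entries : ∀ (i : Fin 4) (j : Fin 3),
    let A := (upperSL * lowerSL * upperSL) ^ (4 - i.val) * (upperSL * lowerSL) ^ (6 - j.val)
    1 ≤ A 0 0 → 0 ≤ A 0 1 → 0 ≤ A 1 0 → 1 ≤ A 1 1 → i = 0 ∧ j = 0 := by
  decide +kernel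

/-- The representation of the three-strand braid group in `SL(2, ℤ)` is faithful modulo the fourth
power of the Garside element. -/
theorem eq_one_of_mem_closure (hst : s * t * s = t * s * t) (hx : (s * t * s) ^ 4 = 1) {q : Q}
    (hq : (q, 1) ∈ Subgroup.closure {(s, upperSL), (t, lowerSL)}) : q = 1 := by
  have hb : (s, upperSL) * (t, lowerSL) * (s, upperSL) =
      (t, lowerSL) * (s, upperSL) * (t, lowerSL) := Prod.ext hst upperSL_braid_lowerSL
  have hx' : ((s, upperSL) * (t, lowerSL) * (s, upperSL)) ^ 4 = 1 :=
    Prod.ext hx garsideSL_pow_four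
  obtain ⟨i, j, hj, m, hm, h⟩ := exists_normal_form hb hx' hq
  rw [← Nat.div_add_mod i 4, pow_add, pow_mul, hx', one_pow, one_mul] at h
  have hi := Nat.mod_lt i (show 4 > 0 by simp)
  generalize i % 4 = i at h hi
  have h2 : 1 = (upperSL * lowerSL * upperSL) ^ i * m.2 * (upperSL * lowerSL) ^ j :=
    congrArg Prod.snd h
  have hy : (upperSL * lowerSL) ^ 6 = 1 := by decide
  have hm2 : m.2 = (upperSL * lowerSL * upperSL) ^ (4 - i) * (upperSL * lowerSL) ^ (6 - j) := by
    rw [pow_sub _ hi.le, garsideSL_pow_four, pow_sub _ (by omega), hy, one_mul, one_mul,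
      eq_mul_inv_iff_mul_eq, eq_inv_iff_mul_eq_one, mul_eq_one_comm, ← mul_assoc, ← h2]
  obtain ⟨h00, h01, h10, h11, hone⟩ := entries_of_mem_closure hm
  obtain ⟨hi0, hj0⟩ := eq_zero_of_entries ⟨i, hi⟩ ⟨j, hj⟩ (by simpa [hm2] using h00)
    (by simpa [hm2] using h01) (by simpa [hm2] using h10) (by simpa [hm2] using h11)
  obtain rfl : i = 0 := congrArg Fin.val hi0
  obtain rfl : j = 0 := congrArg Fin.val hj0
  rw [pow_zero, pow_zero, one_mul, mul_one] at h
  have hm1 : m.2 = 1 := (congrArg Prod.snd h).symm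
  have := hone (by simp [hm1]) (by simp [hm1])
  exact congrArg Prod.fst (h.trans this)

end Matrices

theorem FreeGroup.eq_one_of_forall_commute {α : Type*} [Nontrivial α] {w : FreeGroup α}
    (hw : ∀ a, Commute (FreeGroup.of a) w) : w = 1 := by
  classical
  rw [← FreeGroup.toWord_eq_nil_iff]
  rcases hL : w.toWord with _ | ⟨⟨x, e⟩, L⟩
  · rfl
  exfalso
  obtain ⟨b, hb⟩ := exists_ne x
  have h := congrArg FreeGroup.toWord (hw b).eq
  rw [FreeGroup.toWord_mul, FreeGroup.toWord_mul, hL, FreeGroup.toWord_of] at h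
  have hred : FreeGroup.IsReduced ((b, true) :: (x, e) :: L) := by
    rw [FreeGroup.isReduced_cons_cons]
    refine ⟨fun h => absurd h hb, ?_⟩
    rw [← hL]
    exact FreeGroup.IsReduced.of_reduce_eq (FreeGroup.reduce_toWord w)
  rw [List.singleton_append, hred.reduce_eq] at h
  have hsub : List.Sublist _ _ :=
    (FreeGroup.reduce.red (L := (x, e) :: L ++ [(b, true)])).sublist
  rw [← h] at hsub
  have := hsub.eq_of_length (by simp)
  simp only [List.cons_append, List.cons.injEq, Prod.mk.injEq] at this
  exact hb this.1.1

namespace BraidGroup4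

theorem braid_zero_one : σB 0 * σB 1 * σB 0 = σB 1 * σB 0 * σB 1 :=
  PresentedGroup.mk_eq_mk_of_mul_inv_mem (rels := braidRels4) (by simp [braidRels4])

theorem braid_one_two : σB 1 * σB 2 * σB 1 = σB 2 * σB 1 * σB 2 :=
  PresentedGroup.mk_eq_mk_of_mul_inv_mem (rels := braidRels4) (by simp [braidRels4])

theorem commute_zero_two : σB 0 * σB 2 = σB 2 * σB 0 :=
  PresentedGroup.mk_eq_mk_of_mul_inv_mem (rels := braidRels4) (by simp [braidRels4])

theorem mem_of_generators {H : Subgroup BraidGroup4} (h0 : σB 0 ∈ H) (h1 : σB 1 ∈ H)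
    (h2 : σB 2 ∈ H) (g : BraidGroup4) : g ∈ H := by
  refine PresentedGroup.generated_by braidRels4 H (fun j => ?_) g
  fin_cases j
  exacts [h0, h1, h2]

theorem exists_hom {G : Type*} [Group G] {s t u : G} (hst : s * t * s = t * s * t)
    (htu : t * u * t = u * t * u) (hsu : s * u = u * s) :
    ∃ f : BraidGroup4 →* G, f (σB 0) = s ∧ f (σB 1) = t ∧ f (σB 2) = u := by
  have h : ∀ r ∈ braidRels4, FreeGroup.lift ![s, t, u] r = 1 := by
    rintro r (rfl | rfl | rfl)
    · simp only [map_mul, map_inv, FreeGroup.lift_apply_of, mul_inv_eq_one]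
      exact hst
    · simp only [map_mul, map_inv, FreeGroup.lift_apply_of, mul_inv_eq_one]
      exact htu
    · simp only [map_mul, map_inv, FreeGroup.lift_apply_of, mul_inv_eq_one]
      exact hsu
  exact ⟨PresentedGroup.toGroup h, PresentedGroup.toGroup.of h, PresentedGroup.toGroup.of h,
    PresentedGroup.toGroup.of h⟩

/-- The automorphism of the free group `⟨a, c⟩` by which `σ₁` acts: `a ↦ a`, `c ↦ ca⁻¹`. -/
def autFst : MulAut (FreeGroup (Fin 2)) :=
  MonoidHom.toMulEquiv
    (FreeGroup.lift ![FreeGroup.of 0, FreeGroup.of 1 * (FreeGroup.of 0)⁻¹])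
    (FreeGroup.lift ![FreeGroup.of 0, FreeGroup.of 1 * FreeGroup.of 0])
    (by ext j; fin_cases j <;> simp) (by ext j; fin_cases j <;> simp)

/-- The automorphism of the free group `⟨a, c⟩` by which `σ₂` acts: `a ↦ c`, `c ↦ ca⁻¹c`. -/
def autSnd : MulAut (FreeGroup (Fin 2)) :=
  MonoidHom.toMulEquiv
    (FreeGroup.lift ![FreeGroup.of 1, FreeGroup.of 1 * (FreeGroup.of 0)⁻¹ * FreeGroup.of 1])
    (FreeGroup.lift ![FreeGroup.of 0 * (FreeGroup.of 1)⁻¹ * FreeGroup.of 0, FreeGroup.of 0])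
    (by ext j; fin_cases j <;> simp [mul_assoc]) (by ext j; fin_cases j <;> simp [mul_assoc])

/-- The automorphism of the free group `⟨a, c⟩` by which `σ₃` acts: `a ↦ a`, `c ↦ a⁻¹c`. -/
def autTrd : MulAut (FreeGroup (Fin 2)) :=
  MonoidHom.toMulEquiv
    (FreeGroup.lift ![FreeGroup.of 0, (FreeGroup.of 0)⁻¹ * FreeGroup.of 1])
    (FreeGroup.lift ![FreeGroup.of 0, FreeGroup.of 0 * FreeGroup.of 1])
    (by ext j; fin_cases j <;> simp) (by ext j; fin_cases j <;> simp)

@[simp] theorem autFst_zero : autFst (FreeGroup.of 0) = FreeGroup.of 0 := by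
  simp [autFst]

@[simp] theorem autFst_one : autFst (FreeGroup.of 1) = FreeGroup.of 1 * (FreeGroup.of 0)⁻¹ := by
  simp [autFst]

@[simp] theorem autSnd_zero : autSnd (FreeGroup.of 0) = FreeGroup.of 1 := by
  simp [autSnd]

@[simp] theorem autSnd_one :
    autSnd (FreeGroup.of 1) = FreeGroup.of 1 * (FreeGroup.of 0)⁻¹ * FreeGroup.of 1 := by
  simp [autSnd]

@[simp] theorem autTrd_zero : autTrd (FreeGroup.of 0) = FreeGroup.of 0 := by
  simp [autTrd]

@[simp] theorem autTrd_one : autTrd (FreeGroup.of 1) = (FreeGroup.of 0)⁻¹ * FreeGroup.of 1 := by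
  simp [autTrd]

theorem mulAut_ext {f g : MulAut (FreeGroup (Fin 2))}
    (h0 : f (FreeGroup.of 0) = g (FreeGroup.of 0)) (h1 : f (FreeGroup.of 1) = g (FreeGroup.of 1)) :
    f = g := by
  have : f.toMonoidHom = g.toMonoidHom := by
    ext j
    fin_cases j
    exacts [h0, h1]
  exact MulEquiv.ext fun x => DFunLike.congr_fun this x

theorem exists_action : ∃ φ : BraidGroup4 →* MulAut (FreeGroup (Fin 2)),
    φ (σB 0) = autFst ∧ φ (σB 1) = autSnd ∧ φ (σB 2) = autTrd := by
  apply exists_hom <;> apply mulAut_ext <;> simp [mul_assoc]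

theorem exists_linear : ∃ ρ : BraidGroup4 →* Matrix.SpecialLinearGroup (Fin 2) ℤ,
    ρ (σB 0) = upperSL ∧ ρ (σB 1) = lowerSL ∧ ρ (σB 2) = upperSL :=
  exists_hom upperSL_braid_lowerSL upperSL_braid_lowerSL.symm rfl

/-- The homomorphism from the free group onto the kernel of `B₄ → B₃`. -/
def kernelHom : FreeGroup (Fin 2) →* BraidGroup4 :=
  FreeGroup.lift ![σB 0 * (σB 2)⁻¹, σB 1 * (σB 0 * (σB 2)⁻¹) * (σB 1)⁻¹]

@[simp] theorem kernelHom_zero : kernelHom (FreeGroup.of 0) = σB 0 * (σB 2)⁻¹ :=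
  FreeGroup.lift_apply_of

@[simp] theorem kernelHom_one :
    kernelHom (FreeGroup.of 1) = σB 1 * (σB 0 * (σB 2)⁻¹) * (σB 1)⁻¹ :=
  FreeGroup.lift_apply_of

/-- The abelianization of the free group, in the basis in which the braid group acts through
`upperSL` and `lowerSL`. -/
def abelHom : FreeGroup (Fin 2) →* Multiplicative (Fin 2 → ℤ) :=
  FreeGroup.lift ![Multiplicative.ofAdd ![1, 0], Multiplicative.ofAdd ![1, -1]]

@[simp] theorem abelHom_zero : abelHom (FreeGroup.of 0) = Multiplicative.ofAdd ![1, 0] :=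
  FreeGroup.lift_apply_of

@[simp] theorem abelHom_one : abelHom (FreeGroup.of 1) = Multiplicative.ofAdd ![1, -1] :=
  FreeGroup.lift_apply_of

theorem conj_kernelHom_of_generators {g : BraidGroup4} {f : MulAut (FreeGroup (Fin 2))}
    (h0 : g * kernelHom (FreeGroup.of 0) * g⁻¹ = kernelHom (f (FreeGroup.of 0)))
    (h1 : g * kernelHom (FreeGroup.of 1) * g⁻¹ = kernelHom (f (FreeGroup.of 1)))
    (w : FreeGroup (Fin 2)) : g * kernelHom w * g⁻¹ = kernelHom (f w) := by
  have : (MulAut.conj g).toMonoidHom.comp kernelHom = kernelHom.comp f.toMonoidHom := by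
    ext j
    fin_cases j
    exacts [h0, h1]
  exact DFunLike.congr_fun this w

theorem abelHom_of_generators {A : Matrix.SpecialLinearGroup (Fin 2) ℤ}
    {f : MulAut (FreeGroup (Fin 2))}
    (h0 : (abelHom (f (FreeGroup.of 0))).toAdd =
      (↑A : Matrix (Fin 2) (Fin 2) ℤ) *ᵥ (abelHom (FreeGroup.of 0)).toAdd)
    (h1 : (abelHom (f (FreeGroup.of 1))).toAdd =
      (↑A : Matrix (Fin 2) (Fin 2) ℤ) *ᵥ (abelHom (FreeGroup.of 1)).toAdd)
    (w : FreeGroup (Fin 2)) : (abelHom (f w)).toAdd =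
      (↑A : Matrix (Fin 2) (Fin 2) ℤ) *ᵥ (abelHom w).toAdd := by
  have : abelHom.comp f.toMonoidHom =
      (AddMonoidHom.toMultiplicative
        (mulVecLin (↑A : Matrix (Fin 2) (Fin 2) ℤ)).toAddMonoidHom).comp abelHom := by
    ext1 j
    fin_cases j
    exacts [h0, h1]
  exact DFunLike.congr_fun this w

variable {φ : BraidGroup4 →* MulAut (FreeGroup (Fin 2))}
  {ρ : BraidGroup4 →* Matrix.SpecialLinearGroup (Fin 2) ℤ}

theorem conj_kernelHom (h0 : φ (σB 0) = autFst) (h1 : φ (σB 1) = autSnd) (h2 : φ (σB 2) = autTrd)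
    (g : BraidGroup4) : ∀ w, g * kernelHom w * g⁻¹ = kernelHom (φ g w) := by
  let H : Subgroup BraidGroup4 :=
    { carrier := {g | ∀ w, g * kernelHom w * g⁻¹ = kernelHom (φ g w)}
      one_mem' := by simp
      mul_mem' := by
        intro a b ha hb w
        rw [map_mul, MulAut.mul_apply, ← ha, ← hb]
        group
      inv_mem' := by
        intro a ha w
        have := ha (φ a⁻¹ w)
        rw [← MulAut.mul_apply, ← map_mul, mul_inv_cancel, map_one, MulAut.one_apply] at this
        rw [← this]
        group }
  have c02 : Commute (σB 0) (σB 2) := commute_zero_two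
  refine mem_of_generators (H := H) ?_ ?_ ?_ g
  · refine conj_kernelHom_of_generators ?_ ?_
    · simp only [h0, autFst_zero, kernelHom_zero]
      exact mul_inv_eq_of_eq_mul ((Commute.refl _).mul_right c02.inv_right).eq
    · simpa [h0] using conj_fst braid_zero_one braid_one_two
  · refine conj_kernelHom_of_generators ?_ ?_
    · simp [h1]
    · simpa [h1] using conj_snd braid_zero_one braid_one_two commute_zero_two
  · refine conj_kernelHom_of_generators ?_ ?_
    · simp only [h2, autTrd_zero, kernelHom_zero]
      exact mul_inv_eq_of_eq_mul (c02.symm.mul_right (Commute.refl _).inv_right).eq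
    · simpa [h2] using conj_trd braid_zero_one braid_one_two

theorem abelHom_action (h0 : φ (σB 0) = autFst) (h1 : φ (σB 1) = autSnd) (h2 : φ (σB 2) = autTrd)
    (k0 : ρ (σB 0) = upperSL) (k1 : ρ (σB 1) = lowerSL) (k2 : ρ (σB 2) = upperSL)
    (g : BraidGroup4) : ∀ w, (abelHom (φ g w)).toAdd =
      (↑(ρ g) : Matrix (Fin 2) (Fin 2) ℤ) *ᵥ (abelHom w).toAdd := by
  let H : Subgroup BraidGroup4 :=
    { carrier := {g | ∀ w, (abelHom (φ g w)).toAdd =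
      (↑(ρ g) : Matrix (Fin 2) (Fin 2) ℤ) *ᵥ (abelHom w).toAdd}
      one_mem' := fun w => by
        rw [map_one, map_one, Matrix.SpecialLinearGroup.coe_one, one_mulVec, MulAut.one_apply]
      mul_mem' := by
        intro a b ha hb w
        rw [map_mul, MulAut.mul_apply, ha, hb, map_mul, mulVec_mulVec]
        rfl
      inv_mem' := by
        intro a ha w
        have := ha (φ a⁻¹ w)
        rw [← MulAut.mul_apply, ← map_mul, mul_inv_cancel, map_one, MulAut.one_apply] at this
        rw [this, mulVec_mulVec, ← Matrix.SpecialLinearGroup.coe_mul, ← map_mul, inv_mul_cancel]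
        simp }
  refine mem_of_generators (H := H) ?_ ?_ ?_ g
  · refine abelHom_of_generators ?_ ?_ <;> simp [h0, k0] <;> decide
  · refine abelHom_of_generators ?_ ?_ <;> simp [h1, k1] <;> decide
  · refine abelHom_of_generators ?_ ?_ <;> simp [h2, k2] <;> decide

theorem action_kernelHom (h0 : φ (σB 0) = autFst) (h1 : φ (σB 1) = autSnd)
    (h2 : φ (σB 2) = autTrd) (w : FreeGroup (Fin 2)) : φ (kernelHom w) = MulAut.conj w := by
  have ha : autFst * autTrd⁻¹ = MulAut.conj (FreeGroup.of 0) := by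
    rw [mul_inv_eq_iff_eq_mul]
    apply mulAut_ext <;> simp
  have : φ.comp kernelHom = MulAut.conj := by
    ext1 j
    fin_cases j
    · simpa [h0, h2] using ha
    · simp only [Fin.mk_one, MonoidHom.comp_apply, kernelHom_one, map_mul, map_inv, h0, h1, h2, ha]
      rw [mul_inv_eq_iff_eq_mul]
      apply mulAut_ext <;> simp [mul_assoc]
  exact DFunLike.congr_fun this w

theorem action_eq_one_of_mem_center (h0 : φ (σB 0) = autFst) (h1 : φ (σB 1) = autSnd)
    (h2 : φ (σB 2) = autTrd) {z : BraidGroup4} (hz : z ∈ Subgroup.center BraidGroup4) :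
    φ z = 1 := by
  ext w
  have hc := congrArg φ (Subgroup.mem_center_iff.1 hz (kernelHom w))
  rw [map_mul, map_mul, action_kernelHom h0 h1 h2] at hc
  rw [MulAut.one_apply, eq_comm, ← inv_mul_eq_one]
  refine FreeGroup.eq_one_of_forall_commute fun a => ?_
  have := DFunLike.congr_fun hc ((φ z)⁻¹ (FreeGroup.of a))
  simp only [MulAut.mul_apply, MulAut.conj_apply, map_mul, map_inv, MulAut.apply_inv_self] at this
  show FreeGroup.of a * (w⁻¹ * φ z w) = w⁻¹ * φ z w * FreeGroup.of a
  calc FreeGroup.of a * (w⁻¹ * φ z w)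
      = w⁻¹ * (w * FreeGroup.of a * w⁻¹) * φ z w := by group
    _ = w⁻¹ * φ z w * FreeGroup.of a := by rw [this]; group

theorem full_twist_mem_center : (σB 0 * σB 1 * σB 2) ^ 4 ∈ Subgroup.center BraidGroup4 := by
  obtain ⟨h0, h1, h2⟩ := commute_full_twist braid_zero_one braid_one_two commute_zero_two
  refine Subgroup.mem_center_iff.2 fun g => ?_
  have hg := mem_of_generators (H := Subgroup.centralizer {(σB 0 * σB 1 * σB 2) ^ 4})
    (Subgroup.mem_centralizer_singleton_iff.2 h0.eq)
    (Subgroup.mem_centralizer_singleton_iff.2 h1.eq)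
    (Subgroup.mem_centralizer_singleton_iff.2 h2.eq) g
  exact Subgroup.mem_centralizer_singleton_iff.1 hg

/-- The kernel of the linear representation is generated by the image of `kernelHom` and the full
twist. -/
theorem exists_of_linear_eq_one (k0 : ρ (σB 0) = upperSL) (k1 : ρ (σB 1) = lowerSL)
    (k2 : ρ (σB 2) = upperSL) {z : BraidGroup4} (hz : ρ z = 1) :
    ∃ w : FreeGroup (Fin 2), ∃ n : ℤ, kernelHom w * ((σB 0 * σB 1 * σB 2) ^ 4) ^ n = z := by
  obtain ⟨φ, h0, h1, h2⟩ := exists_action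
  have hK : (kernelHom.range).Normal := by
    refine ⟨?_⟩
    rintro _ ⟨w, rfl⟩ g
    exact ⟨φ g w, (conj_kernelHom h0 h1 h2 g w).symm⟩
  have hD : (Subgroup.zpowers ((σB 0 * σB 1 * σB 2) ^ 4)).Normal := by
    refine ⟨fun d hd g => ?_⟩
    have hc := (Subgroup.zpowers_le.2 full_twist_mem_center) hd
    rwa [Subgroup.mem_center_iff.1 hc g, mul_inv_cancel_right]
  set H := kernelHom.range ⊔ Subgroup.zpowers ((σB 0 * σB 1 * σB 2) ^ 4)
  have hHn : H.Normal := inferInstance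
  let q : BraidGroup4 →* BraidGroup4 ⧸ H := QuotientGroup.mk' H
  have hq02 : q (σB 0) = q (σB 2) := by
    rw [← mul_inv_eq_one, ← map_inv, ← map_mul]
    exact (QuotientGroup.eq_one_iff _).2 (Subgroup.mem_sup_left ⟨FreeGroup.of 0, kernelHom_zero⟩)
  have hqD : (q (σB 0) * q (σB 1) * q (σB 0)) ^ 4 = 1 := by
    nth_rw 2 [hq02]
    rw [← map_mul, ← map_mul, ← map_pow]
    exact (QuotientGroup.eq_one_iff _).2 (Subgroup.mem_sup_right (Subgroup.mem_zpowers _))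
  have hqb : q (σB 0) * q (σB 1) * q (σB 0) = q (σB 1) * q (σB 0) * q (σB 1) := by
    simp only [← map_mul, braid_zero_one]
  have hmem := mem_of_generators
    (H := (Subgroup.closure {(q (σB 0), upperSL), (q (σB 1), lowerSL)}).comap (q.prod ρ))
    (Subgroup.subset_closure (by simp [k0])) (Subgroup.subset_closure (by simp [k1]))
    (Subgroup.subset_closure (by simp [k2, hq02])) z
  rw [Subgroup.mem_comap, MonoidHom.prod_apply, hz] at hmem
  have hzH : z ∈ H := (QuotientGroup.eq_one_iff z).1 (eq_one_of_mem_closure hqb hqD hmem)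
  obtain ⟨_, ⟨w, rfl⟩, _, ⟨n, rfl⟩, h⟩ := Subgroup.mem_sup_of_normal_left.1 hzH
  exact ⟨w, n, h⟩

theorem mem_zpowers_of_mem_center {z : BraidGroup4} (hz : z ∈ Subgroup.center BraidGroup4) :
    z ∈ Subgroup.zpowers ((σB 0 * σB 1 * σB 2) ^ 4) := by
  obtain ⟨φ, h0, h1, h2⟩ := exists_action
  obtain ⟨ρ, k0, k1, k2⟩ := exists_linear
  have hρ : ρ z = 1 := by
    have hab := abelHom_action h0 h1 h2 k0 k1 k2 z
    rw [action_eq_one_of_mem_center h0 h1 h2 hz] at hab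
    have ha := hab (FreeGroup.of 0)
    have hc := hab (FreeGroup.of 1)
    simp only [MulAut.one_apply, abelHom_zero, abelHom_one, toAdd_ofAdd] at ha hc
    have ha0 := congrFun ha 0
    have ha1 := congrFun ha 1
    have hc0 := congrFun hc 0
    have hc1 := congrFun hc 1
    simp [mulVec, dotProduct, Fin.sum_univ_two] at ha0 ha1 hc0 hc1
    ext i j
    fin_cases i <;> fin_cases j <;> simp <;> omega
  obtain ⟨w, n, rfl⟩ := exists_of_linear_eq_one k0 k1 k2 hρ
  have hw : kernelHom w ∈ Subgroup.center BraidGroup4 :=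
    (Subgroup.mul_mem_cancel_right _ (zpow_mem full_twist_mem_center n)).1 hz
  have hconj := action_eq_one_of_mem_center h0 h1 h2 hw
  rw [action_kernelHom h0 h1 h2] at hconj
  have hw1 : w = 1 := FreeGroup.eq_one_of_forall_commute fun a =>
    (mul_inv_eq_iff_eq_mul.1 (DFunLike.congr_fun hconj (FreeGroup.of a))).symm
  rw [hw1, map_one, one_mul]
  exact Subgroup.zpow_mem_zpowers _ n

end BraidGroup4

/-- The center of `B₄` is generated by `(σ₁σ₂σ₃)⁴`. -/
theorem center_b4 :
    Subgroup.center BraidGroup4 = Subgroup.zpowers ((σB 0 * σB 1 * σB 2) ^ 4) := by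
  refine le_antisymm (fun _ => BraidGroup4.mem_zpowers_of_mem_center) ?_
  exact Subgroup.zpowers_le.2 BraidGroup4.full_twist_mem_center
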